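/- Let g, g′ be Riemannian metrics on Ω ⊆ V, Ω′ ⊆ V′ admitting Levi-Civita connection forms A, A′ of class C¹, with curvatures R, R′, and let F : Ω → Ω′ be a C² isometry between g and g′. Then for all v ∈ Ω and ξ, η, ζ ∈ V, R′(F(v))(DF(v)ξ, DF(v)η)(DF(v)ζ) = DF(v)(R(v)(ξ, η)ζ). -/

import Mathlib

open scoped Topology

noncomputable section

/-- A Riemannian metric on `Ω`: a family of symmetric positive definite continuous bilinear
forms. -/
def IsRiemannianMetric {V : Type*} [NormedAddCommGroup V] [NormedSpace ℝ V]
    (Ω : Set V) (g : V → V →L[ℝ] V →L[ℝ] ℝ) : Prop :=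
  (∀ v ∈ Ω, ∀ ξ η : V, g v ξ η = g v η ξ) ∧ ∀ v ∈ Ω, ∀ ξ : V, ξ ≠ 0 → 0 < g v ξ ξ

/-- `A` is a Levi-Civita connection form for `g` on `Ω` (torsion-free and compatible). -/
def IsLeviCivita {V : Type*} [NormedAddCommGroup V] [NormedSpace ℝ V]
    (Ω : Set V) (g : V → V →L[ℝ] V →L[ℝ] ℝ) (A : V → V →L[ℝ] V →L[ℝ] V) : Prop :=
  (∀ v ∈ Ω, ∀ ξ η : V, A v ξ η = A v η ξ) ∧
  ∀ v ∈ Ω, ∀ η ζ : V, HasFDerivAt (fun w => g w η ζ)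
    (((g v).flip ζ).comp ((A v).flip η) + ((g v) η).comp ((A v).flip ζ)) v

/-- The curvature of a connection form `A`. -/
def curvature {V W : Type*} [NormedAddCommGroup V] [NormedSpace ℝ V]
    [NormedAddCommGroup W] [NormedSpace ℝ W]
    (A : V → V →L[ℝ] W →L[ℝ] W) (v : V) (ξ η : V) : W →L[ℝ] W :=
  fderiv ℝ A v ξ η - fderiv ℝ A v η ξ + (A v ξ).comp (A v η) - (A v η).comp (A v ξ)

/-- If the derivatives of a family of functions are controlled by a small multiple of the
uniform bounds of the family and the family is uniformly bounded on `[s, t]`, then a bound at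
one point doubles to a bound on `[s, t]`. -/
theorem abs_le_two_mul_of_uniformly_bounded {ι : Type*} {a b C s t : ℝ} {f f' : ι → ℝ → ℝ}
    (hC : 0 ≤ C)
    (hd : ∀ i, ∀ u ∈ Set.Icc a b, HasDerivAt (f i) (f' i u) u)
    (hf' : ∀ u ∈ Set.Icc a b, ∀ K, (∀ j, |f j u| ≤ K) → ∀ i, |f' i u| ≤ C * K)
    (hsmall : 2 * C * (b - a) ≤ 1) (hst : Set.Icc s t ⊆ Set.Icc a b)
    (hbd : ∃ K, ∀ u ∈ Set.Icc s t, ∀ j, |f j u| ≤ K)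
    {K : ℝ} {x y : ℝ} (hx : x ∈ Set.Icc s t) (hy : y ∈ Set.Icc s t)
    (hK : ∀ j, |f j x| ≤ K) (j : ι) : |f j y| ≤ 2 * K := by
  obtain ⟨K₀, hK₀⟩ := hbd
  set S : Set ℝ := {r | ∃ u ∈ Set.Icc s t, ∃ i, r = |f i u|} with hS
  have hSb : BddAbove S := ⟨K₀, by rintro r ⟨u, hu, i, rfl⟩; exact hK₀ u hu i⟩
  have hle : ∀ u ∈ Set.Icc s t, ∀ i, |f i u| ≤ sSup S :=
    fun u hu i => le_csSup hSb ⟨u, hu, i, rfl⟩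
  have h0 : 0 ≤ sSup S := (abs_nonneg _).trans (hle y hy j)
  have key : ∀ u ∈ Set.Icc s t, ∀ i, |f i u| ≤ K + sSup S / 2 := by
    intro u hu i
    have h1 : ‖f i u - f i x‖ ≤ C * sSup S * ‖u - x‖ :=
      (convex_Icc s t).norm_image_sub_le_of_norm_hasDerivWithin_le
        (fun w hw => (hd i w (hst hw)).hasDerivWithinAt)
        (fun w hw => hf' w (hst hw) _ (hle w hw) i) hx hu
    have h2 : ‖u - x‖ ≤ b - a := by
      have := hst hu; have := hst hx
      simp only [Set.mem_Icc] at *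
      rw [Real.norm_eq_abs, abs_le]; constructor <;> linarith
    have h3 : C * sSup S * ‖u - x‖ ≤ sSup S / 2 := by
      calc C * sSup S * ‖u - x‖ ≤ C * sSup S * (b - a) := by gcongr
        _ = sSup S * (2 * C * (b - a)) / 2 := by ring
        _ ≤ sSup S * 1 / 2 := by gcongr
        _ = sSup S / 2 := by ring
    have h4 : |f i u| ≤ |f i x| + |f i u - f i x| := by
      simpa using abs_add_le (f i x) (f i u - f i x)
    have := hK i
    rw [Real.norm_eq_abs] at h1
    linarith
  have h5 : sSup S ≤ K + sSup S / 2 :=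
    csSup_le ⟨_, y, hy, j, rfl⟩ (by rintro r ⟨u, hu, i, rfl⟩; exact key u hu i)
  linarith [hle y hy j]

/-- A pointwise bounded family of functions on a short interval, whose derivatives are
controlled by the uniform bounds of the family, is uniformly bounded. -/
theorem uniformly_bounded_of_pointwise_bounded {ι : Type*} {a b C : ℝ} {f f' : ι → ℝ → ℝ}
    (hC : 0 ≤ C)
    (hd : ∀ i, ∀ u ∈ Set.Icc a b, HasDerivAt (f i) (f' i u) u)
    (hf' : ∀ u ∈ Set.Icc a b, ∀ K, (∀ j, |f j u| ≤ K) → ∀ i, |f' i u| ≤ C * K)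
    (hsmall : 2 * C * (b - a) ≤ 1)
    (hpt : ∀ u ∈ Set.Icc a b, ∃ K, ∀ j, |f j u| ≤ K) :
    ∃ K, ∀ u ∈ Set.Icc a b, ∀ j, |f j u| ≤ K := by
  set G : Set ℝ := ⋃₀ {U | IsOpen U ∧ ∃ K, ∀ u ∈ U ∩ Set.Icc a b, ∀ j, |f j u| ≤ K} with hG
  have hGo : IsOpen G := isOpen_sUnion fun U hU => hU.1
  have hloc : ∀ T : Set ℝ, IsCompact T → T ⊆ Set.Icc a b → T ⊆ G →
      ∃ K, ∀ u ∈ T, ∀ j, |f j u| ≤ K := by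
    intro T hT hTI hTG
    refine hT.induction_on (p := fun T => ∃ K, ∀ u ∈ T, ∀ j, |f j u| ≤ K) ⟨0, by simp⟩ ?_ ?_ ?_
    · rintro s t hst ⟨K, hK⟩
      exact ⟨K, fun u hu => hK u (hst hu)⟩
    · rintro s t ⟨K, hK⟩ ⟨L, hL⟩
      refine ⟨max K L, ?_⟩
      rintro u (hu | hu) j
      · exact (hK u hu j).trans (le_max_left _ _)
      · exact (hL u hu j).trans (le_max_right _ _)
    · intro x hx
      obtain ⟨U, ⟨hUo, K, hK⟩, hxU⟩ := hTG hx
      exact ⟨U ∩ T, Filter.inter_mem (mem_nhdsWithin_of_mem_nhds (hUo.mem_nhds hxU))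
        self_mem_nhdsWithin, K, fun u hu => hK u ⟨hu.1, hTI hu.2⟩⟩
  refine hloc _ isCompact_Icc subset_rfl ?_
  by_contra hne
  set P : Set ℝ := Set.Icc a b \ G with hP
  have hPc : IsClosed P := isClosed_Icc.sdiff hGo
  have hPne : P.Nonempty := Set.sdiff_nonempty.2 hne
  have : Nonempty P := hPne.to_subtype
  have : CompleteSpace P := hPc.completeSpace_coe
  obtain ⟨N, p, hp⟩ := nonempty_interior_of_iUnion_of_closed
    (f := fun N : ℕ => {q : P | ∀ j, |f j q| ≤ N})
    (by
      intro N
      have : {q : P | ∀ j, |f j q| ≤ N} = ⋂ j, {q : P | |f j q| ≤ N} := by ext; simp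
      rw [this]
      refine isClosed_iInter fun j => isClosed_le ?_ continuous_const
      refine Continuous.abs (continuous_iff_continuousAt.2 fun q => ?_)
      exact (hd j q q.2.1).continuousAt.comp continuous_subtype_val.continuousAt)
    (by
      refine Set.eq_univ_of_forall fun q => ?_
      obtain ⟨K, hK⟩ := hpt q q.2.1
      obtain ⟨N, hN⟩ := exists_nat_ge K
      exact Set.mem_iUnion.2 ⟨N, fun j => (hK j).trans hN⟩)
  rw [mem_interior_iff_mem_nhds, Metric.mem_nhds_iff] at hp
  obtain ⟨r, hr, hball⟩ := hp
  have hPN : ∀ q ∈ P, |q - p| < r → ∀ j, |f j q| ≤ N := fun q hq hqr =>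
    hball (show (⟨q, hq⟩ : P) ∈ Metric.ball p r by
      rw [Metric.mem_ball, Subtype.dist_eq, Real.dist_eq]; exact hqr)
  refine p.2.2 ⟨Metric.ball p r, ⟨Metric.isOpen_ball, 2 * N, ?_⟩, Metric.mem_ball_self hr⟩
  rintro t ⟨htr, htI⟩ j
  rw [Metric.mem_ball, Real.dist_eq] at htr
  obtain ⟨M, hM⟩ := hpt t htI
  have hcl : ∀ q ∈ P, |q - p| < r → (∀ w ∈ Set.uIcc q t, w ≠ q → w ∉ P) → |f j t| ≤ 2 * N := by
    intro q hqP hqr hgap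
    have hsub : Set.uIcc q t ⊆ Set.Icc a b := Set.uIcc_subset_Icc hqP.1 htI
    have hbd : ∃ K, ∀ u ∈ Set.Icc (min q t) (max q t), ∀ j, |f j u| ≤ K := by
      refine ⟨max N (2 * M), fun u hu i => ?_⟩
      by_cases huq : u = q
      · subst huq
        exact (hPN u hqP hqr i).trans (le_max_left _ _)
      · have hut : Set.uIcc u t ⊆ Set.uIcc q t := Set.uIcc_subset_uIcc hu Set.right_mem_uIcc
        refine (abs_le_two_mul_of_uniformly_bounded hC hd hf' hsmall (hut.trans hsub)
          (hloc _ isCompact_uIcc (hut.trans hsub) fun w hw => ?_) Set.right_mem_uIcc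
          Set.left_mem_uIcc hM i).trans (le_max_right _ _)
        by_contra hwG
        refine hgap w (hut hw) ?_ ⟨hsub (hut hw), hwG⟩
        rintro rfl
        exact huq (Set.eq_of_mem_uIcc_of_mem_uIcc hu hw)
    exact abs_le_two_mul_of_uniformly_bounded hC hd hf' hsmall hsub hbd
      Set.left_mem_uIcc Set.right_mem_uIcc (hPN q hqP hqr) j
  have hcomp : IsCompact (P ∩ Set.uIcc (p : ℝ) t) := isCompact_uIcc.inter_left hPc
  have hnon : (P ∩ Set.uIcc (p : ℝ) t).Nonempty := ⟨p, p.2, Set.left_mem_uIcc⟩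
  obtain ⟨q, ⟨hqP, hqI⟩, hmin⟩ := hcomp.exists_isMinOn hnon
    (f := fun w => |w - t|) (by fun_prop)
  refine hcl q hqP ?_ fun w hw hwq hwP => ?_
  · rw [abs_lt] at htr ⊢
    rcases Set.mem_uIcc.1 hqI with h | h <;> constructor <;> linarith
  · have h1 : |q - t| ≤ |w - t| :=
      hmin ⟨hwP, Set.uIcc_subset_uIcc hqI Set.right_mem_uIcc hw⟩
    refine hwq ?_
    rcases Set.mem_uIcc.1 hw with h | h
    · rw [abs_of_nonpos (by linarith), abs_of_nonpos (by linarith)] at h1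
      linarith
    · rw [abs_of_nonneg (by linarith), abs_of_nonneg (by linarith)] at h1
      linarith

/-- Product rule for a pointwise differentiable, locally bounded family of functionals. -/
theorem HasDerivAt.clm_apply_of_pointwise {X : Type*} [NormedAddCommGroup X] [NormedSpace ℝ X]
    {T : ℝ → X →L[ℝ] ℝ} {d : X → ℝ} {t₀ K : ℝ} {a : ℝ → X} {a' : X}
    (hT : ∀ᶠ t in 𝓝 t₀, ‖T t‖ ≤ K) (hd : ∀ x, HasDerivAt (fun t => T t x) (d x) t₀)
    (ha : HasDerivAt a a' t₀) :
    HasDerivAt (fun t => T t (a t)) (d (a t₀) + T t₀ a') t₀ := by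
  have h1 : HasDerivAt (fun t => (t - t₀) * T t a') (T t₀ a') t₀ := by
    have h := ((hasDerivAt_id t₀).sub_const t₀).mul (hd a')
    simp only [id, sub_self, zero_mul, add_zero, one_mul] at h
    exact h
  have h2 : HasDerivAt (fun t => T t (a t - a t₀ - (t - t₀) • a')) 0 t₀ := by
    rw [hasDerivAt_iff_isLittleO]
    have hr := hasDerivAt_iff_isLittleO.1 ha
    refine Asymptotics.IsBigO.trans_isLittleO ?_ hr
    refine Asymptotics.IsBigO.of_bound K ?_
    filter_upwards [hT] with t ht
    simpa using (T t).le_of_opNorm_le ht (a t - a t₀ - (t - t₀) • a')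
  have h3 := ((hd (a t₀)).add h1).add h2
  rw [add_zero] at h3
  refine h3.congr_of_eventuallyEq (.of_forall fun t => ?_)
  simp only [Pi.add_apply, map_sub, map_smul, smul_eq_mul]
  ring

/-- A time-dependent bilinear form `B` that satisfies pointwise the linear differential equation
`B' = B(L ·, ·) + B(·, L ·)`, with `L` locally bounded, is locally bounded in norm. -/
theorem eventually_norm_le_of_hasDerivAt_bilin {X : Type*} [NormedAddCommGroup X]
    [NormedSpace ℝ X] {B : ℝ → X →L[ℝ] X →L[ℝ] ℝ} {L : ℝ → X →L[ℝ] X} {t₀ C : ℝ}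
    (hL : ∀ᶠ t in 𝓝 t₀, ‖L t‖ ≤ C)
    (hB : ∀ᶠ t in 𝓝 t₀, ∀ η ζ, HasDerivAt (fun s => B s η ζ)
      (B t (L t η) ζ + B t η (L t ζ)) t) :
    ∃ K, ∀ᶠ t in 𝓝 t₀, ‖B t‖ ≤ K := by
  have hC : 0 ≤ C := (norm_nonneg _).trans hL.self_of_nhds
  obtain ⟨ε, hε, hball⟩ := Metric.eventually_nhds_iff_ball.1 (hL.and hB)
  set δ : ℝ := min (ε / 2) (1 / (8 * (C + 1))) with hδ
  have hδ0 : 0 < δ := by positivity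
  have hmem : ∀ t ∈ Set.Icc (t₀ - δ) (t₀ + δ), t ∈ Metric.ball t₀ ε := by
    intro t ht
    have : δ ≤ ε / 2 := min_le_left _ _
    rw [Metric.mem_ball, Real.dist_eq, abs_lt]
    constructor <;> linarith [ht.1, ht.2]
  have hnorm : ∀ t K, (∀ p : {p : X × X // ‖p.1‖ ≤ 1 ∧ ‖p.2‖ ≤ 1},
      |B t p.1.1 p.1.2| ≤ K) → ‖B t‖ ≤ K := by
    intro t K h
    have hK : 0 ≤ K := (abs_nonneg _).trans (h ⟨(0, 0), by simp⟩)
    exact ContinuousLinearMap.opNorm_le_of_unit_norm hK fun x hx =>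
      ContinuousLinearMap.opNorm_le_of_unit_norm hK fun y hy => h ⟨(x, y), hx.le, hy.le⟩
  have happly : ∀ t x y (c d : ℝ), ‖x‖ ≤ c → ‖y‖ ≤ d → |B t x y| ≤ ‖B t‖ * c * d := by
    intro t x y c d hx hy
    have hc := (norm_nonneg x).trans hx
    calc |B t x y| ≤ ‖B t‖ * ‖x‖ * ‖y‖ := (B t).le_opNorm₂ x y
      _ ≤ ‖B t‖ * c * d := by gcongr
  obtain ⟨K, hK⟩ := uniformly_bounded_of_pointwise_bounded
    (ι := {p : X × X // ‖p.1‖ ≤ 1 ∧ ‖p.2‖ ≤ 1}) (a := t₀ - δ) (b := t₀ + δ) (C := 2 * C)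
    (f := fun p t => B t p.1.1 p.1.2)
    (f' := fun p t => B t (L t p.1.1) p.1.2 + B t p.1.1 (L t p.1.2)) (by positivity)
    (fun p t ht => (hball t (hmem t ht)).2 _ _)
    (by
      rintro t ht K hK ⟨⟨x, y⟩, hx, hy⟩
      have hLt := (hball t (hmem t ht)).1
      have hLx : ∀ z : X, ‖z‖ ≤ 1 → ‖L t z‖ ≤ C := fun z hz =>
        ((L t).le_of_opNorm_le hLt z).trans (mul_le_of_le_one_right hC hz)
      have h1 := happly t _ _ _ _ (hLx x hx) hy
      have h2 := happly t _ _ _ _ hx (hLx y hy)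
      have h3 : ‖B t‖ * C ≤ K * C := by gcongr; exact hnorm t K hK
      calc _ ≤ |B t (L t x) y| + |B t x (L t y)| := abs_add_le _ _
        _ ≤ 2 * C * K := by linarith)
    (by
      have h1 : δ ≤ 1 / (8 * (C + 1)) := min_le_right _ _
      rw [le_div_iff₀ (by positivity)] at h1
      nlinarith)
    (fun t _ => ⟨‖B t‖, fun p => by simpa using happly t _ _ _ _ p.2.1 p.2.2⟩)
  refine ⟨K, ?_⟩
  filter_upwards [Icc_mem_nhds (sub_lt_self t₀ hδ0) (lt_add_of_pos_right t₀ hδ0)] with t ht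
  exact hnorm t K (hK t ht)

/-- Product rule for `t ↦ B t (a t) (b t)`, where `B` is locally bounded and only pointwise
differentiable. -/
theorem HasDerivAt.bilin_apply_of_pointwise {X : Type*} [NormedAddCommGroup X] [NormedSpace ℝ X]
    {B : ℝ → X →L[ℝ] X →L[ℝ] ℝ} {d : X → X → ℝ} {t₀ K : ℝ} {a b : ℝ → X} {a' b' : X}
    (hB : ∀ᶠ t in 𝓝 t₀, ‖B t‖ ≤ K)
    (hd : ∀ x y, HasDerivAt (fun t => B t x y) (d x y) t₀)
    (ha : HasDerivAt a a' t₀) (hb : HasDerivAt b b' t₀) :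
    HasDerivAt (fun t => B t (a t) (b t))
      (d (a t₀) (b t₀) + B t₀ a' (b t₀) + B t₀ (a t₀) b') t₀ := by
  have hK : 0 ≤ K := (norm_nonneg (B t₀)).trans hB.self_of_nhds
  have h1 : ∀ y, HasDerivAt (fun t => B t (a t) y) (d (a t₀) y + B t₀ a' y) t₀ := by
    intro y
    refine HasDerivAt.clm_apply_of_pointwise (T := fun t => (B t).flip y)
      (d := fun x => d x y) (K := K * ‖y‖) ?_ (fun x => hd x y) ha
    filter_upwards [hB] with t ht
    calc ‖(B t).flip y‖ ≤ ‖(B t).flip‖ * ‖y‖ := (B t).flip.le_opNorm y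
      _ ≤ K * ‖y‖ := by rw [ContinuousLinearMap.opNorm_flip]; gcongr
  refine HasDerivAt.clm_apply_of_pointwise (T := fun t => B t (a t))
    (d := fun y => d (a t₀) y + B t₀ a' y) (K := K * (‖a t₀‖ + 1)) ?_ h1 hb
  filter_upwards [hB, ha.continuousAt.norm.eventually_lt_const
    (lt_add_one ‖a t₀‖)] with t ht hat
  calc ‖B t (a t)‖ ≤ ‖B t‖ * ‖a t‖ := (B t).le_opNorm _
    _ ≤ K * (‖a t₀‖ + 1) := by gcongr

/-- An isometry transforms the Levi-Civita connection forms into one another. -/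
theorem IsLeviCivita.fderiv_fderiv_isometry {V V' : Type*}
    [NormedAddCommGroup V] [NormedSpace ℝ V] [NormedAddCommGroup V'] [NormedSpace ℝ V']
    {Ω : Set V} (hΩ : IsOpen Ω) {Ω' : Set V'} (hΩ' : IsOpen Ω')
    {g : V → V →L[ℝ] V →L[ℝ] ℝ} (hg : IsRiemannianMetric Ω g)
    {g' : V' → V' →L[ℝ] V' →L[ℝ] ℝ} (hg' : IsRiemannianMetric Ω' g')
    {A : V → V →L[ℝ] V →L[ℝ] V} (hA : IsLeviCivita Ω g A)
    {A' : V' → V' →L[ℝ] V' →L[ℝ] V'} (hA'c : ContinuousOn A' Ω') (hA' : IsLeviCivita Ω' g' A')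
    {F : V → V'} (hF : ContDiffOn ℝ 2 F Ω) (hFΩ : Set.MapsTo F Ω Ω')
    (hsurj : ∀ v ∈ Ω, Function.Surjective (fderiv ℝ F v))
    (hiso : ∀ v ∈ Ω, ∀ ξ : V,
      g' (F v) (fderiv ℝ F v ξ) (fderiv ℝ F v ξ) = g v ξ ξ)
    {v : V} (hv : v ∈ Ω) (ξ η : V) :
    fderiv ℝ (fderiv ℝ F) v ξ η =
      fderiv ℝ F v (A v ξ η) - A' (F v) (fderiv ℝ F v ξ) (fderiv ℝ F v η) := by
  have hpol : ∀ w ∈ Ω, ∀ η ζ : V,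
      g' (F w) (fderiv ℝ F w η) (fderiv ℝ F w ζ) = g w η ζ := by
    intro w hw η ζ
    have h := hiso w hw (η + ζ)
    simp only [map_add, add_apply] at h
    rw [hiso w hw η, hiso w hw ζ, hg.1 w hw ζ η,
      hg'.1 _ (hFΩ hw) (fderiv ℝ F w ζ) (fderiv ℝ F w η)] at h
    linarith
  have hFv : ContDiffAt ℝ 2 F v := hF.contDiffAt (hΩ.mem_nhds hv)
  have hDF : DifferentiableAt ℝ (fderiv ℝ F) v :=
    (hFv.fderiv_right (m := 1) (by norm_num)).differentiableAt (by norm_num)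
  have hsymm : ∀ ξ η, fderiv ℝ (fderiv ℝ F) v ξ η = fderiv ℝ (fderiv ℝ F) v η ξ :=
    hFv.isSymmSndFDerivAt (by simp)
  have hFd : ∀ w ∈ Ω, HasFDerivAt F (fderiv ℝ F w) w := fun w hw =>
    ((hF.contDiffAt (hΩ.mem_nhds hw)).differentiableAt (by norm_num)).hasFDerivAt
  -- the compatibility conditions along the line through `v` in the direction `ξ`
  have hcompat : ∀ ξ η ζ : V,
      g' (F v) (fderiv ℝ (fderiv ℝ F) v ξ η
        + A' (F v) (fderiv ℝ F v ξ) (fderiv ℝ F v η) - fderiv ℝ F v (A v ξ η))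
          (fderiv ℝ F v ζ)
      + g' (F v) (fderiv ℝ (fderiv ℝ F) v ξ ζ
        + A' (F v) (fderiv ℝ F v ξ) (fderiv ℝ F v ζ) - fderiv ℝ F v (A v ξ ζ))
          (fderiv ℝ F v η) = 0 := by
    intro ξ η ζ
    set c : ℝ → V := fun t => v + t • ξ with hc
    have hc0 : c 0 = v := by simp [hc]
    have hcd : ∀ t, HasDerivAt c ξ t := fun t => by
      have h := ((hasDerivAt_id t).smul_const ξ).const_add v
      rw [one_smul] at h
      exact h
    have hcΩ : ∀ᶠ t in 𝓝 (0 : ℝ), c t ∈ Ω :=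
      (hcd 0).continuousAt.eventually_mem (hΩ.mem_nhds (by rwa [hc0]))
    have hode : ∀ᶠ t in 𝓝 (0 : ℝ), ∀ x y, HasDerivAt (fun s => g' (F (c s)) x y)
        (g' (F (c t)) (A' (F (c t)) (fderiv ℝ F (c t) ξ) x) y
          + g' (F (c t)) x (A' (F (c t)) (fderiv ℝ F (c t) ξ) y)) t := by
      filter_upwards [hcΩ] with t ht x y
      have h1 := (hFd _ ht).comp_hasDerivAt t (hcd t)
      exact (hA'.2 _ (hFΩ ht) x y).comp_hasDerivAt t h1
    have hLc : ContinuousAt (fun t => A' (F (c t)) (fderiv ℝ F (c t) ξ)) 0 := by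
      have hcc : ContinuousAt c 0 := (hcd 0).continuousAt
      have h1 : ContinuousAt (fun t => fderiv ℝ F (c t)) 0 :=
        ContinuousAt.comp (by rw [hc0]; exact hDF.continuousAt) hcc
      have h2 : ContinuousAt (fun t => F (c t)) 0 :=
        ContinuousAt.comp (by rw [hc0]; exact hFv.continuousAt) hcc
      have h3 : ContinuousAt (fun t => A' (F (c t))) 0 :=
        ContinuousAt.comp (f := fun t => F (c t))
          (by rw [hc0]; exact hA'c.continuousAt (hΩ'.mem_nhds (hFΩ hv))) h2
      exact h3.clm_apply (h1.clm_apply continuousAt_const)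
    obtain ⟨K, hK⟩ := eventually_norm_le_of_hasDerivAt_bilin
      (B := fun t => g' (F (c t))) (L := fun t => A' (F (c t)) (fderiv ℝ F (c t) ξ))
      ((hLc.norm.eventually_lt_const (lt_add_one _)).mono fun _ => le_of_lt) hode
    have hDFd : ∀ η, HasDerivAt (fun t => fderiv ℝ F (c t) η)
        (fderiv ℝ (fderiv ℝ F) v ξ η) 0 := by
      intro η
      have h1 : HasDerivAt (fun t => fderiv ℝ F (c t)) (fderiv ℝ (fderiv ℝ F) v ξ) 0 :=
        HasFDerivAt.comp_hasDerivAt (0 : ℝ) (by rw [hc0]; exact hDF.hasFDerivAt) (hcd 0)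
      simpa using h1.clm_apply (hasDerivAt_const (0 : ℝ) η)
    have hleft := HasDerivAt.bilin_apply_of_pointwise hK
      (fun x y => hode.self_of_nhds x y) (hDFd η) (hDFd ζ)
    have hright : HasDerivAt (fun t => g (c t) η ζ) (g v (A v ξ η) ζ + g v η (A v ξ ζ)) 0 :=
      HasFDerivAt.comp_hasDerivAt (l := fun w => g w η ζ)
        (l' := ((g v).flip ζ).comp ((A v).flip η) + ((g v) η).comp ((A v).flip ζ)) (0 : ℝ)
        (by rw [hc0]; exact hA.2 v hv η ζ) (hcd 0)
    have heq := hleft.unique (hright.congr_of_eventuallyEq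
      (hcΩ.mono fun t ht => hpol (c t) ht η ζ))
    simp only [hc0] at heq
    rw [← hpol v hv, ← hpol v hv] at heq
    simp only [map_add, map_sub, add_apply, sub_apply]
    have hs := hg'.1 _ (hFΩ hv)
    rw [hs _ (fderiv ℝ F v η), hs _ (fderiv ℝ F v η), hs _ (fderiv ℝ F v η)]
    linarith
  set S : V → V → V' := fun ξ η => fderiv ℝ (fderiv ℝ F) v ξ η
        + A' (F v) (fderiv ℝ F v ξ) (fderiv ℝ F v η) - fderiv ℝ F v (A v ξ η) with hS
  have hSsymm : ∀ ξ η, S ξ η = S η ξ := by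
    intro ξ η
    simp only [hS]
    rw [hsymm ξ η, hA.1 v hv ξ η, hA'.1 _ (hFΩ hv) (fderiv ℝ F v ξ)]
  have hS0 : ∀ ζ, g' (F v) (S ξ η) (fderiv ℝ F v ζ) = 0 := by
    intro ζ
    have h1 : g' (F v) (S ξ η) (fderiv ℝ F v ζ) + g' (F v) (S ξ ζ) (fderiv ℝ F v η) = 0 :=
      hcompat ξ η ζ
    have h2 : g' (F v) (S η ζ) (fderiv ℝ F v ξ) + g' (F v) (S η ξ) (fderiv ℝ F v ζ) = 0 :=
      hcompat η ζ ξ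
    have h3 : g' (F v) (S ζ ξ) (fderiv ℝ F v η) + g' (F v) (S ζ η) (fderiv ℝ F v ξ) = 0 :=
      hcompat ζ ξ η
    rw [hSsymm η ξ] at h2
    rw [hSsymm ζ ξ, hSsymm ζ η] at h3
    linarith
  have hzero : S ξ η = 0 := by
    by_contra hne
    obtain ⟨ζ, hζ⟩ := hsurj v hv (S ξ η)
    have := hg'.2 _ (hFΩ hv) _ hne
    rw [← hS0 ζ, hζ] at this
    exact lt_irrefl _ this
  rw [eq_sub_iff_add_eq]
  exact sub_eq_zero.1 hzero

theorem DifferentiableAt.clm_flip {V E : Type*} [NormedAddCommGroup V] [NormedSpace ℝ V]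
    [NormedAddCommGroup E] [NormedSpace ℝ E] {B : V → E →L[ℝ] E →L[ℝ] E} {v : V}
    (hB : DifferentiableAt ℝ B v) : DifferentiableAt ℝ (fun w => (B w).flip) v :=
  DifferentiableAt.comp (g := ContinuousLinearMap.flip) v
    (ContinuousLinearMap.flipₗᵢ ℝ E E E).differentiableAt hB

/-- A `C²` map that intertwines two connection forms of class `C¹` intertwines their
curvatures. -/
theorem curvature_fderiv_of_fderiv_fderiv {V V' : Type*}
    [NormedAddCommGroup V] [NormedSpace ℝ V] [NormedAddCommGroup V'] [NormedSpace ℝ V']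
    {A : V → V →L[ℝ] V →L[ℝ] V} {A' : V' → V' →L[ℝ] V' →L[ℝ] V'} {F : V → V'} {v : V}
    (hA : DifferentiableAt ℝ A v) (hA' : DifferentiableAt ℝ A' (F v)) (hF : ContDiffAt ℝ 2 F v)
    (h : ∀ᶠ w in 𝓝 v, ∀ ξ η, fderiv ℝ (fderiv ℝ F) w ξ η =
      fderiv ℝ F w (A w ξ η) - A' (F w) (fderiv ℝ F w ξ) (fderiv ℝ F w η)) (ξ η ζ : V) :
    curvature A' (F v) (fderiv ℝ F v ξ) (fderiv ℝ F v η) (fderiv ℝ F v ζ) =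
      fderiv ℝ F v (curvature A v ξ η ζ) := by
  have hDF : ∀ᶠ w in 𝓝 v, DifferentiableAt ℝ (fderiv ℝ F) w := by
    filter_upwards [hF.eventually (by simp)] with w hw
    exact (hw.fderiv_right (m := 1) (by norm_num)).differentiableAt (by norm_num)
  have hDFv := hDF.self_of_nhds.hasFDerivAt
  have hFv := (hF.differentiableAt (by norm_num)).hasFDerivAt
  have hA'F : HasFDerivAt (fun w => A' (F w)) ((fderiv ℝ A' (F v)).comp (fderiv ℝ F v)) v :=
    HasFDerivAt.comp (g := A') v hA'.hasFDerivAt hFv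
  have hsymm : ∀ ξ η, fderiv ℝ (fderiv ℝ F) v ξ η = fderiv ℝ (fderiv ℝ F) v η ξ :=
    hF.isSymmSndFDerivAt (by simp)
  set Ψ : V → V →L[ℝ] V' := fun w => (fderiv ℝ F w).comp ((A w).flip ζ)
    - ((A' (F w)).flip (fderiv ℝ F w ζ)).comp (fderiv ℝ F w) with hΨ
  have hΦ : ∀ᶠ w in 𝓝 v, HasFDerivAt (fun w => fderiv ℝ F w ζ) (Ψ w) w := by
    filter_upwards [hDF, h] with w hw hw'
    convert hw.hasFDerivAt.clm_apply (hasFDerivAt_const ζ w) using 1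
    ext η
    simp [hΨ, hw']
  have hΨd : DifferentiableAt ℝ Ψ v :=
    (hDF.self_of_nhds.clm_comp (hA.clm_flip.clm_apply (differentiableAt_const ζ))).sub
      ((hA'F.differentiableAt.clm_flip.clm_apply
        (hDF.self_of_nhds.clm_apply (differentiableAt_const ζ))).clm_comp hDF.self_of_nhds)
  have hformula : ∀ ξ η, fderiv ℝ Ψ v ξ η =
      fderiv ℝ (fderiv ℝ F) v ξ (A v η ζ) + fderiv ℝ F v (fderiv ℝ A v ξ η ζ)
      - (fderiv ℝ A' (F v) (fderiv ℝ F v ξ) (fderiv ℝ F v η) (fderiv ℝ F v ζ)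
        + A' (F v) (fderiv ℝ (fderiv ℝ F) v ξ η) (fderiv ℝ F v ζ)
        + A' (F v) (fderiv ℝ F v η) (fderiv ℝ (fderiv ℝ F) v ξ ζ)) := by
    intro ξ η
    have hη := hasFDerivAt_const (𝕜 := ℝ) η v
    have hζ := hasFDerivAt_const (𝕜 := ℝ) ζ v
    have h1 := hΨd.hasFDerivAt.clm_apply hη
    have h2 := (hDFv.clm_apply ((hA.hasFDerivAt.clm_apply hη).clm_apply hζ)).sub
      ((hA'F.clm_apply (hDFv.clm_apply hη)).clm_apply (hDFv.clm_apply hζ))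
    have h3 := congrArg (fun T : V →L[ℝ] V' => T ξ) (h1.unique h2)
    simp at h3
    rw [h3]
    abel
  have hΨsymm := second_derivative_symmetric_of_eventually hΦ hΨd.hasFDerivAt ξ η
  rw [hformula, hformula, hsymm η ξ] at hΨsymm
  have hv := h.self_of_nhds
  simp only [hv ξ (A v η ζ), hv η (A v ξ ζ), hv ξ ζ, hv η ζ, map_sub] at hΨsymm
  simp only [curvature, add_apply, sub_apply, ContinuousLinearMap.comp_apply, map_add, map_sub]
  rw [← sub_eq_zero] at hΨsymm ⊢
  rw [← neg_eq_zero, ← hΨsymm]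
  abel

/-- Transformation of curvature under a `C²` isometry
`F : (Ω, g) → (Ω', g')`:
`R'(F v)(DF(v)ξ, DF(v)η)(DF(v)ζ) = DF(v)(R(v)(ξ, η)ζ)`. -/
theorem statement9 {V V' : Type*} [NormedAddCommGroup V] [NormedSpace ℝ V]
    [NormedAddCommGroup V'] [NormedSpace ℝ V']
    (Ω : Set V) (hΩ : IsOpen Ω) (Ω' : Set V') (hΩ' : IsOpen Ω')
    (g : V → V →L[ℝ] V →L[ℝ] ℝ) (hg : IsRiemannianMetric Ω g)
    (g' : V' → V' →L[ℝ] V' →L[ℝ] ℝ) (hg' : IsRiemannianMetric Ω' g')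
    (A : V → V →L[ℝ] V →L[ℝ] V) (hA1 : ContDiffOn ℝ 1 A Ω) (hALC : IsLeviCivita Ω g A)
    (A' : V' → V' →L[ℝ] V' →L[ℝ] V') (hA'1 : ContDiffOn ℝ 1 A' Ω')
    (hA'LC : IsLeviCivita Ω' g' A')
    (F : V → V') (G : V' → V)
    (hF : ContDiffOn ℝ 2 F Ω) (him : F '' Ω ⊆ Ω') (hopen : IsOpen (F '' Ω))
    (hG : ContDiffOn ℝ 2 G (F '' Ω)) (hGF : ∀ v ∈ Ω, G (F v) = v)
    (hiso : ∀ v ∈ Ω, ∀ ξ : V,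
      g' (F v) (fderiv ℝ F v ξ) (fderiv ℝ F v ξ) = g v ξ ξ) :
    ∀ v ∈ Ω, ∀ ξ η ζ : V,
      curvature A' (F v) (fderiv ℝ F v ξ) (fderiv ℝ F v η) (fderiv ℝ F v ζ) =
        fderiv ℝ F v (curvature A v ξ η ζ) := by
  have hFΩ : Set.MapsTo F Ω Ω' := fun v hv => him ⟨v, hv, rfl⟩
  have hsurj : ∀ v ∈ Ω, Function.Surjective (fderiv ℝ F v) := by
    intro v hv
    have hFv : F v ∈ F '' Ω := ⟨v, hv, rfl⟩
    have hGd : HasFDerivAt G (fderiv ℝ G (F v)) (F v) :=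
      ((hG.contDiffAt (hopen.mem_nhds hFv)).differentiableAt (by norm_num)).hasFDerivAt
    have hFd : HasFDerivAt F (fderiv ℝ F v) (G (F v)) := by
      rw [hGF v hv]
      exact ((hF.contDiffAt (hΩ.mem_nhds hv)).differentiableAt (by norm_num)).hasFDerivAt
    have hid : HasFDerivAt (F ∘ G) (ContinuousLinearMap.id ℝ V') (F v) := by
      refine (hasFDerivAt_id (F v)).congr_of_eventuallyEq ?_
      filter_upwards [hopen.mem_nhds hFv]
      rintro _ ⟨w, hw, rfl⟩
      simp [hGF w hw]
    exact fun y => ⟨fderiv ℝ G (F v) y,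
      congrArg (fun T : V' →L[ℝ] V' => T y) ((hFd.comp (F v) hGd).unique hid)⟩
  intro v hv ξ η ζ
  refine curvature_fderiv_of_fderiv_fderiv
    ((hA1.contDiffAt (hΩ.mem_nhds hv)).differentiableAt (by norm_num))
    ((hA'1.contDiffAt (hΩ'.mem_nhds (hFΩ hv))).differentiableAt (by norm_num))
    (hF.contDiffAt (hΩ.mem_nhds hv)) ?_ ξ η ζ
  filter_upwards [hΩ.mem_nhds hv] with w hw ξ η
  exact hALC.fderiv_fderiv_isometry hΩ hΩ' hg hg' hA'1.continuousOn hA'LC hF hFΩ hsurj hiso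
    hw ξ η
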